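/- arXiv:1406.4928 — 5 statements merged into one kernel-verified Lean document; each statement's English description precedes it below -/
import Mathlib

section
/- Let r ∈ (0,1). The infimum of α₁₁+α₂₁+α₁ᵣ+α₂ᵣ+α_RD over all tuples (α₁₁, α₂₁, α₁ᵣ, α₂ᵣ, α_RD) of nonnegative real numbers satisfying r/2 > (1/2)·max(0, 1−α₁₁, 1−α₁ᵣ) + (1/2)·max(0, 1−α₁₁) equals 2 − r. -/
/-- Outage exponent `d₁` of the single-user outage event `O_{R₁}` in the GQF scheme:
the infimum of `α₁₁+α₂₁+α₁ᵣ+α₂ᵣ+α_RD` over the outage set `O⁺_{R₁} ⊆ ℝ₊⁵` equals `2 - r`. -/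
theorem stmt_0 (r : ℝ) (hr0 : 0 < r) (hr1 : r < 1) :
    sInf {x : ℝ | ∃ a11 a21 a1r a2r ard : ℝ,
      0 ≤ a11 ∧ 0 ≤ a21 ∧ 0 ≤ a1r ∧ 0 ≤ a2r ∧ 0 ≤ ard ∧
      r / 2 > (1 / 2) * max 0 (max (1 - a11) (1 - a1r)) + (1 / 2) * max 0 (1 - a11) ∧
      x = a11 + a21 + a1r + a2r + ard} = 2 - r := by
  have mem_of_pos (ε : ℝ) (hε : 0 < ε) : ∃ a11 a21 a1r a2r ard : ℝ,
      0 ≤ a11 ∧ 0 ≤ a21 ∧ 0 ≤ a1r ∧ 0 ≤ a2r ∧ 0 ≤ ard ∧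
      r / 2 > (1 / 2) * max 0 (max (1 - a11) (1 - a1r)) + (1 / 2) * max 0 (1 - a11) ∧
      2 - r + ε = a11 + a21 + a1r + a2r + ard := by
    refine ⟨1, 0, 1 - r + ε, 0, 0, by norm_num, le_rfl, by linarith, le_rfl, le_rfl, ?_, by ring⟩
    have hmax : max 0 (max 0 (1 - (1 - r + ε))) < r :=
      max_lt hr0 (max_lt hr0 (by linarith))
    rw [sub_self, max_self]
    linarith
  apply csInf_eq_of_forall_ge_of_forall_gt_exists_lt
  · exact ⟨_, mem_of_pos 1 one_pos⟩
  · rintro x ⟨a11, a21, a1r, a2r, ard, -, h21, -, h2r, hrd, hout, rfl⟩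
    have h1r : 1 - a1r ≤ max 0 (max (1 - a11) (1 - a1r)) :=
      (le_max_right _ _).trans (le_max_right _ _)
    have h11 : 1 - a11 ≤ max 0 (1 - a11) := le_max_right _ _
    linarith
  · intro w hw
    exact ⟨_, mem_of_pos ((w - (2 - r)) / 2) (by linarith), by linarith⟩
end

section
/- Let r ∈ (0,1). The infimum of α₁₁+α₂₁+α₁ᵣ+α₂ᵣ+α_RD over all tuples (α₁₁, α₂₁, α₁ᵣ, α₂ᵣ, α_RD) of nonnegative real numbers satisfying r + 1 > max(0, 1−α₁₁) + max(0, 1−α₁ᵣ, 1−α₂ᵣ) + max(0, 1−α₁₁, 1−α_RD) equals 2 − r. -/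
/-- Outage exponent `d₁ᵤ` of the outage event `O_{R₁ᵤ}` in the GQF scheme:
the infimum of `α₁₁+α₂₁+α₁ᵣ+α₂ᵣ+α_RD` over the outage set `O⁺_{R₁ᵤ} ⊆ ℝ₊⁵`
equals `2 − r`. -/
theorem stmt_4 (r : ℝ) (hr0 : 0 < r) (hr1 : r < 1) :
    sInf {x : ℝ | ∃ a11 a21 a1r a2r ard : ℝ,
      0 ≤ a11 ∧ 0 ≤ a21 ∧ 0 ≤ a1r ∧ 0 ≤ a2r ∧ 0 ≤ ard ∧
      r + 1 > max 0 (1 - a11) + max 0 (max (1 - a1r) (1 - a2r))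
        + max 0 (max (1 - a11) (1 - ard)) ∧
      x = a11 + a21 + a1r + a2r + ard} = 2 - r := by
  refine Eq.trans (congrArg sInf ?_) (csInf_Ioi (a := 2 - r))
  ext x
  simp only [Set.mem_ofPred_eq, Set.mem_Ioi]
  constructor
  · rintro ⟨a11, a21, a1r, a2r, ard, h11, h21, h1r, h2r, hrd, hout, rfl⟩
    have direct := le_max_right 0 (1 - a11)
    have relay := (le_max_left (1 - a1r) (1 - a2r)).trans (le_max_right 0 _)
    have forward := (le_max_right (1 - a11) (1 - ard)).trans (le_max_right 0 _)
    linarith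
  · intro hx
    refine ⟨1, 0, 0, 0, x - 1, by norm_num, le_rfl, le_rfl, le_rfl, by linarith, ?_, by ring⟩
    have forward : max 0 (max (1 - 1) (1 - (x - 1))) < r :=
      max_lt hr0 (max_lt (by linarith) (by linarith))
    norm_num at forward ⊢
    grind
end

section
/- Let r ∈ (0,1). The infimum of α₁₁+α₂₁+α₁ᵣ+α₂ᵣ+α_RD over all tuples (α₁₁, α₂₁, α₁ᵣ, α₂ᵣ, α_RD) of nonnegative real numbers satisfying 2r > max(0, 1−α₁₁, 1−α₂₁, 1−α₁ᵣ, 1−α₂ᵣ) + max(0, 1−α₁₁, 1−α₂₁) equals 4(1 − r). -/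
/-- Outage exponent `d₁₂` of the sum-rate outage event `O_{R₁₂}` in the GQF scheme:
the infimum of `α₁₁+α₂₁+α₁ᵣ+α₂ᵣ+α_RD` over the outage set `O⁺_{R₁₂} ⊆ ℝ₊⁵`
equals `4(1 − r)`. -/
theorem stmt_5 (r : ℝ) (hr0 : 0 < r) (hr1 : r < 1) :
    sInf {x : ℝ | ∃ a11 a21 a1r a2r ard : ℝ,
      0 ≤ a11 ∧ 0 ≤ a21 ∧ 0 ≤ a1r ∧ 0 ≤ a2r ∧ 0 ≤ ard ∧
      2 * r > max 0 (max (max (1 - a11) (1 - a21)) (max (1 - a1r) (1 - a2r)))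
        + max 0 (max (1 - a11) (1 - a21)) ∧
      x = a11 + a21 + a1r + a2r + ard} = 4 * (1 - r) := by
  have feasible : ∀ t : ℝ, 0 ≤ t → t < r → ∃ a11 a21 a1r a2r ard : ℝ,
      0 ≤ a11 ∧ 0 ≤ a21 ∧ 0 ≤ a1r ∧ 0 ≤ a2r ∧ 0 ≤ ard ∧
      2 * r > max 0 (max (max (1 - a11) (1 - a21)) (max (1 - a1r) (1 - a2r)))
        + max 0 (max (1 - a11) (1 - a21)) ∧
      4 * (1 - t) = a11 + a21 + a1r + a2r + ard := by
    intro t ht htr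
    refine ⟨1 - t, 1 - t, 1 - t, 1 - t, 0, by linarith, by linarith, by linarith, by linarith,
      le_rfl, ?_, by ring⟩
    simp only [max_self, sub_sub_cancel, max_eq_right ht]
    linarith
  apply csInf_eq_of_forall_ge_of_forall_gt_exists_lt
  · exact ⟨_, feasible 0 le_rfl hr0⟩
  · rintro x ⟨a11, a21, a1r, a2r, ard, -, -, -, -, hard, hout, rfl⟩
    set M := max 0 (max (max (1 - a11) (1 - a21)) (max (1 - a1r) (1 - a2r))) with hM
    set N := max 0 (max (1 - a11) (1 - a21)) with hN
    have h11 : 1 - a11 ≤ N := by simp [hN]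
    have h21 : 1 - a21 ≤ N := by simp [hN]
    have h1r : 1 - a1r ≤ M := by simp [hM]
    have h2r : 1 - a2r ≤ M := by simp [hM]
    linarith
  · intro w hw
    obtain ⟨t, ht, htr⟩ := exists_between (max_lt hr0 (by linarith : 1 - w / 4 < r))
    obtain ⟨ht0, htw⟩ := max_lt_iff.mp ht
    exact ⟨_, feasible t ht0.le htr, by linarith⟩
end

section
/- Let r ∈ (0,1). The infimum of α₁₁+α₂₁+α₁ᵣ+α₂ᵣ+α_RD over all tuples (α₁₁, α₂₁, α₁ᵣ, α₂ᵣ, α_RD) of nonnegative real numbers satisfying 2r + 1 > max(0, 1−α₁₁, 1−α₂₁) + max(0, 1−α₁ᵣ, 1−α₂ᵣ) + max(0, 1−α₁₁, 1−α₂₁, 1−α_RD) equals 3(1 − r). -/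
/-- Outage exponent `d₁₂ᵤ` of the outage event `O_{R₁₂ᵤ}` in the GQF scheme:
the infimum of `α₁₁+α₂₁+α₁ᵣ+α₂ᵣ+α_RD` over the outage set `O⁺_{R₁₂ᵤ} ⊆ ℝ₊⁵`
equals `3(1 − r)`. -/
theorem stmt_6 (r : ℝ) (hr0 : 0 < r) (hr1 : r < 1) :
    sInf {x : ℝ | ∃ a11 a21 a1r a2r ard : ℝ,
      0 ≤ a11 ∧ 0 ≤ a21 ∧ 0 ≤ a1r ∧ 0 ≤ a2r ∧ 0 ≤ ard ∧
      2 * r + 1 > max 0 (max (1 - a11) (1 - a21)) + max 0 (max (1 - a1r) (1 - a2r))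
        + max 0 (max (max (1 - a11) (1 - a21)) (1 - ard)) ∧
      x = a11 + a21 + a1r + a2r + ard} = 3 * (1 - r) := by
  have hpoint : ∀ t : ℝ, 0 ≤ t → t < r → 3 * (1 - t) ∈ {x : ℝ | ∃ a11 a21 a1r a2r ard : ℝ,
      0 ≤ a11 ∧ 0 ≤ a21 ∧ 0 ≤ a1r ∧ 0 ≤ a2r ∧ 0 ≤ ard ∧
      2 * r + 1 > max 0 (max (1 - a11) (1 - a21)) + max 0 (max (1 - a1r) (1 - a2r))
        + max 0 (max (max (1 - a11) (1 - a21)) (1 - ard)) ∧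
      x = a11 + a21 + a1r + a2r + ard} := by
    intro t ht0 htr
    refine ⟨1 - t, 1 - t, 0, 0, 1 - t, by linarith, by linarith, le_rfl, le_rfl, by linarith,
      ?_, by ring⟩
    simp only [sub_sub_cancel, sub_zero, max_self, max_eq_right ht0,
      max_eq_right (zero_le_one' ℝ)]
    linarith
  apply csInf_eq_of_forall_ge_of_forall_gt_exists_lt
  · exact ⟨_, hpoint 0 le_rfl hr0⟩
  · rintro x ⟨a11, a21, a1r, a2r, ard, -, -, h1r, h2r, -, hout, rfl⟩
    set A := max 0 (max (1 - a11) (1 - a21)) with hA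
    set B := max 0 (max (1 - a1r) (1 - a2r)) with hB
    set C := max 0 (max (max (1 - a11) (1 - a21)) (1 - ard)) with hC
    have hA1 : 1 - a11 ≤ A := by simp [hA]
    have hA2 : 1 - a21 ≤ A := by simp [hA]
    have hB1 : 1 - a1r ≤ B := by simp [hB]
    have hB2 : 1 - a2r ≤ B := by simp [hB]
    have hC1 : 1 - ard ≤ C := by simp [hC]
    have hAC : A ≤ C := max_le_max_left 0 (le_max_left _ _)
    have hB_le : B ≤ 1 := max_le zero_le_one (max_le (by linarith) (by linarith))
    linarith
  · intro w hw
    obtain ⟨t, ht, htr⟩ := exists_between (max_lt hr0 (by linarith : 1 - w / 3 < r))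
    rw [max_lt_iff] at ht
    exact ⟨_, hpoint t ht.1.le htr, by linarith [ht.2]⟩
end

section
/- Let r ∈ (0,1). The infimum of α₁₁+α₂₁+α₁ᵣ+α₂ᵣ+α_RD over all tuples of nonnegative real numbers satisfying α₁₁ ≤ 1, α₁₁ ≤ α₂₁, α₁₁ ≤ α_RD, α₁ᵣ ≤ 1, α₁ᵣ ≤ α₂ᵣ, and 2r + 1 > 2(1−α₁₁) + (1−α₁ᵣ) equals 3(1 − r). -/
/-- Case 1-1-1 of the optimization determining the outage exponent `d₁₂ᵤ`
of the GQF scheme: the infimum of `α₁₁+α₂₁+α₁ᵣ+α₂ᵣ+α_RD` over the indicated region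
equals `3(1 − r)`. -/
theorem stmt_8 (r : ℝ) (hr0 : 0 < r) (hr1 : r < 1) :
    sInf {x : ℝ | ∃ a11 a21 a1r a2r ard : ℝ,
      0 ≤ a11 ∧ 0 ≤ a21 ∧ 0 ≤ a1r ∧ 0 ≤ a2r ∧ 0 ≤ ard ∧
      a11 ≤ 1 ∧ a11 ≤ a21 ∧ a11 ≤ ard ∧ a1r ≤ 1 ∧ a1r ≤ a2r ∧
      2 * r + 1 > 2 * (1 - a11) + (1 - a1r) ∧
      x = a11 + a21 + a1r + a2r + ard} = 3 * (1 - r) := by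
  refine csInf_eq_of_forall_ge_of_forall_gt_exists_lt ?_ ?_ ?_
  · exact ⟨3, 1, 1, 0, 0, 1, by norm_num, by norm_num, by norm_num, by norm_num, by norm_num,
      by norm_num, by norm_num, by norm_num, by norm_num, by norm_num, by linarith, by norm_num⟩
  · rintro x ⟨a11, a21, a1r, a2r, ard, h11, h21, h1r, h2r, hrd, h11', h21', hrd', h1r', h2r', h, rfl⟩
    linarith
  · intro w hw
    obtain ⟨a, ha, ha'⟩ := exists_between (lt_min (by linarith : 1 - r < w / 3)
      (by linarith : 1 - r < 1))
    obtain ⟨haw, ha1⟩ := lt_min_iff.1 ha'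
    refine ⟨3 * a, ⟨a, a, 0, 0, a, ?_, ?_, le_rfl, le_rfl, ?_, ha1.le, le_rfl, le_rfl,
      zero_le_one, le_rfl, ?_, ?_⟩, ?_⟩ <;> linarith
end
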